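/- Second doublet difference term at the fiber surface: there exist constants C > 0 and ε₀ > 0, depending only on c_Γ and κ_max, such that for all 0 < ε < ε₀, 0 < δ < ε₀, every f ∈ C¹(ℝ/ℤ; ℝ³), every s ∈ ℝ/ℤ and θ ∈ [0,2π), the quantity D₂ = −(3/2) ∫_{−1/2}^{1/2} ( (ε²+δ²)/(|R|² + δ²)^{5/2} − ε²/|R|⁵ ) (R Rᵀ) f(s − s̄) ds̄ (with R = R(s,s̄,θ)) satisfies |D₂ − (2δ²/(ε² + δ²)) e_ρ(s,θ)(e_ρ(s,θ)·f(s))| ≤ C (ε² + δ²)^{1/2} ‖f‖_{C¹}. -/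

import Mathlib

open MeasureTheory

noncomputable section

local notation "⟪" x ", " y "⟫" => @inner ℝ _ _ x y

abbrev V3 : Type := EuclideanSpace ℝ (Fin 3)

/-- The `C⁰` (sup) norm of a function `ℝ/ℤ → ℝ³`. -/
def C0norm (f : ℝ → V3) : ℝ := ⨆ s : ℝ, ‖f s‖

/-- The `C¹` norm of a function `ℝ/ℤ → ℝ³`. -/
def C1norm (f : ℝ → V3) : ℝ := C0norm f + C0norm (deriv f)

/-- The radial unit vector `e_ρ(s,θ) = cos θ e_{n1}(s) + sin θ e_{n2}(s)`. -/
def ePerp (en1 en2 : ℝ → V3) (s θ : ℝ) : V3 :=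
  Real.cos θ • en1 s + Real.sin θ • en2 s

/-- `R(s, s̄, θ) = X(s) + ε e_ρ(s,θ) − X(s − s̄)`. -/
def Rvec (X en1 en2 : ℝ → V3) (ε s sb θ : ℝ) : V3 :=
  X s + ε • ePerp en1 en2 s θ - X (s - sb)

/-- The slender-body geometry hypotheses: `X : ℝ/ℤ → ℝ³` is a `C²` closed curve
parameterized by arclength, non-self-intersecting with constant `cΓ`, with curvature
bounded by `κmax`, together with a `C¹` orthonormal frame `(X', en1, en2)`. -/
structure SlenderGeom (cΓ κmax : ℝ) (X en1 en2 : ℝ → V3) : Prop where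
  smooth : ContDiff ℝ 2 X
  periodicX : ∀ s, X (s + 1) = X s
  arclength : ∀ s, ‖deriv X s‖ = 1
  no_self_intersect : ∀ s t : ℝ, |s - t| ≤ 1 / 2 → cΓ * |s - t| ≤ ‖X s - X t‖
  curvature_max : ∀ s, ‖deriv (deriv X) s‖ ≤ κmax
  en1_smooth : ContDiff ℝ 1 en1
  en2_smooth : ContDiff ℝ 1 en2
  en1_periodic : ∀ s, en1 (s + 1) = en1 s
  en2_periodic : ∀ s, en2 (s + 1) = en2 s
  en1_unit : ∀ s, ‖en1 s‖ = 1
  en2_unit : ∀ s, ‖en2 s‖ = 1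
  es_en1 : ∀ s, ⟪deriv X s, en1 s⟫ = 0
  es_en2 : ∀ s, ⟪deriv X s, en2 s⟫ = 0
  en1_en2 : ∀ s, ⟪en1 s, en2 s⟫ = 0

/-- The singular Stokeslet `S(y) v = v/|y| + (y·v) y/|y|³`. -/
def stokeslet (y v : V3) : V3 := ‖y‖⁻¹ • v + (‖y‖ ^ 3)⁻¹ • ⟪y, v⟫ • y

/-- The singular doublet `D(y) v = v/|y|³ − 3 (y·v) y/|y|⁵`. -/
def doubletK (y v : V3) : V3 := (‖y‖ ^ 3)⁻¹ • v - (3 * (‖y‖ ^ 5)⁻¹) • ⟪y, v⟫ • y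

/-- The regularized Stokeslet `S_δ(y) v`. -/
def stokesletReg (δ : ℝ) (y v : V3) : V3 :=
  ((‖y‖ ^ 2 + δ ^ 2) ^ ((1 : ℝ) / 2))⁻¹ • v
    + ((‖y‖ ^ 2 + δ ^ 2) ^ ((3 : ℝ) / 2))⁻¹ • (⟪y, v⟫ • y + δ ^ 2 • v)

/-- The regularized doublet `D_δ(y) v`. -/
def doubletReg (δ : ℝ) (y v : V3) : V3 :=
  ((‖y‖ ^ 2 + δ ^ 2) ^ ((3 : ℝ) / 2))⁻¹ • v
    - (3 * ((‖y‖ ^ 2 + δ ^ 2) ^ ((5 : ℝ) / 2))⁻¹) • (⟪y, v⟫ • y + δ ^ 2 • v)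

/-- The classical slender-body velocity `u^SB(x)` with doublet coefficient `ε²/2`. -/
def uSB (X f : ℝ → V3) (ε : ℝ) (x : V3) : V3 :=
  (8 * Real.pi)⁻¹ • ∫ t in (0:ℝ)..1,
    (stokeslet (x - X t) (f t) + (ε ^ 2 / 2) • doubletK (x - X t) (f t))

/-- The regularized slender-body velocity with doublet coefficient `β`. -/
def uReg (X f : ℝ → V3) (β δ : ℝ) (x : V3) : V3 :=
  (8 * Real.pi)⁻¹ • ∫ t in (0:ℝ)..1,
    (stokesletReg δ (x - X t) (f t) + β • doubletReg δ (x - X t) (f t))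

/-- The Keller–Rubinow classical centerline velocity `u^SB_C(X(s))`. -/
def uSBC (X f : ℝ → V3) (ε s : ℝ) : V3 :=
  (8 * Real.pi)⁻¹ •
    ((f s - (3 : ℝ) • ⟪deriv X s, f s⟫ • deriv X s
        - (2 * Real.log (Real.pi * ε / 4)) • (f s + ⟪deriv X s, f s⟫ • deriv X s))
      + ∫ t in (0:ℝ)..1,
          ((‖X s - X t‖⁻¹ • f t
              + (‖X s - X t‖ ^ 3)⁻¹ • ⟪X s - X t, f t⟫ • (X s - X t))
            - |Real.sin (Real.pi * (s - t)) / Real.pi|⁻¹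
                • (f s + ⟪deriv X s, f s⟫ • deriv X s)))

/-- The regularized pressure `p^δ(x)`. -/
def pReg (X f : ℝ → V3) (δ : ℝ) (x : V3) : ℝ :=
  (4 * Real.pi)⁻¹ * ∫ t in (0:ℝ)..1,
    (⟪x - X t, f t⟫ * ((‖x - X t‖ ^ 2 + δ ^ 2) ^ ((3 : ℝ) / 2))⁻¹
      + 3 * δ ^ 2 * ⟪x - X t, f t⟫ * (2 * (‖x - X t‖ ^ 2 + δ ^ 2) ^ ((5 : ℝ) / 2))⁻¹)

/-- The symmetric strain tensor `E(u) = (∇u + (∇u)ᵀ)/2` applied to the vector `n`. -/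
def strainApply (u : V3 → V3) (x n : V3) : V3 :=
  (2 : ℝ)⁻¹ • (fderiv ℝ u x n + gradient (fun y => ⟪u y, n⟫) x)

/-- The surface Jacobian `J_ε(s,θ) = ε(1 − ε(κ₁ cos θ + κ₂ sin θ))`. -/
def Jfac (X en1 en2 : ℝ → V3) (ε s θ : ℝ) : ℝ :=
  ε * (1 - ε * (⟪deriv (deriv X) s, en1 s⟫ * Real.cos θ
      + ⟪deriv (deriv X) s, en2 s⟫ * Real.sin θ))

/-- The regularized surface force density
`f^δ(s) = ∫_0^{2π} (2 E(u^δ) n − p^δ n) J_ε dθ`, with `n = −e_ρ`. -/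
def fReg (X en1 en2 f : ℝ → V3) (ε δ s : ℝ) : V3 :=
  ∫ θ in (0:ℝ)..(2 * Real.pi),
    Jfac X en1 en2 ε s θ •
      ((2 : ℝ) • strainApply (uReg X f ((ε ^ 2 + δ ^ 2) / 2) δ)
          (X s + ε • ePerp en1 en2 s θ) (-ePerp en1 en2 s θ)
        - pReg X f δ (X s + ε • ePerp en1 en2 s θ) • (-ePerp en1 en2 s θ))

/-- The vector field `d_n^δ[f](x)`. -/
def dReg (X f : ℝ → V3) (δ : ℝ) (n : ℕ) (x : V3) : V3 :=
  (8 * Real.pi)⁻¹ • ∫ t in (0:ℝ)..1,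
    (δ ^ 2 * ((‖x - X t‖ ^ 2 + δ ^ 2) ^ ((n : ℝ) / 2))⁻¹) • f t

/-- The scalar field `d_5^δ[f·R](x)`. -/
def dRegP (X f : ℝ → V3) (δ : ℝ) (x : V3) : ℝ :=
  (8 * Real.pi)⁻¹ * ∫ t in (0:ℝ)..1,
    δ ^ 2 * ⟪x - X t, f t⟫ * ((‖x - X t‖ ^ 2 + δ ^ 2) ^ ((5 : ℝ) / 2))⁻¹

/-- The extra force contribution
`F^δ(s) = ∫_0^{2π} (2E(d₃^δ[f])n − 3(ε²+δ²)E(d₅^δ[f])n − 3 d₅^δ[f·R] n) J_ε dθ`. -/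
def Fextra (X en1 en2 f : ℝ → V3) (ε δ s : ℝ) : V3 :=
  ∫ θ in (0:ℝ)..(2 * Real.pi),
    Jfac X en1 en2 ε s θ •
      ((2 : ℝ) • strainApply (dReg X f δ 3) (X s + ε • ePerp en1 en2 s θ)
          (-ePerp en1 en2 s θ)
        - (3 * (ε ^ 2 + δ ^ 2)) • strainApply (dReg X f δ 5)
            (X s + ε • ePerp en1 en2 s θ) (-ePerp en1 en2 s θ)
        - (3 * dRegP X f δ (X s + ε • ePerp en1 en2 s θ)) • (-ePerp en1 en2 s θ))

lemma abs_inv_pow_five_sub_le {P Q m K y : ℝ} (hP : 0 < P) (hm : 0 < m) (hm1 : m ≤ 1)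
    (hQ : m * P ≤ Q) (hK : 0 ≤ K * y) (h : |Q ^ 2 - P ^ 2| ≤ K * y * P ^ 2) :
    |(Q ^ 5)⁻¹ - (P ^ 5)⁻¹| ≤ 5 * (K * y) / m ^ 5 * (P ^ 5)⁻¹ := by
  have hQ0 : 0 < Q := lt_of_lt_of_le (by positivity) hQ
  set r := P / Q with hr
  have hr0 : 0 < r := by positivity
  have hrm : r ≤ 1 / m := by
    rw [hr, div_le_div_iff₀ hQ0 hm]; linarith
  have hm1' : 1 ≤ 1 / m := by rw [le_div_iff₀ hm]; linarith
  have hPQ : |P - Q| ≤ K * y * P := by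
    have h1 : |Q ^ 2 - P ^ 2| = |P - Q| * (P + Q) := by
      rw [← abs_of_pos (show 0 < P + Q by positivity), ← abs_mul, abs_sub_comm]
      ring_nf
    rw [h1] at h
    have h2 : |P - Q| * P ≤ |P - Q| * (P + Q) := by gcongr; linarith
    have h3 : |P - Q| * P ≤ (K * y * P) * P := by linarith [h2, h]
    exact le_of_mul_le_mul_right h3 hP
  have hr1 : |r - 1| ≤ K * y * (1 / m) := by
    have : r - 1 = (P - Q) / Q := by rw [hr]; field_simp
    rw [this, abs_div, abs_of_pos hQ0]
    calc |P - Q| / Q ≤ K * y * P / Q := by gcongr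
      _ = K * y * r := by rw [hr]; ring
      _ ≤ _ := by gcongr
  have hsum : 1 + r + r ^ 2 + r ^ 3 + r ^ 4 ≤ 5 * (1 / m) ^ 4 := by
    have a1 : r ≤ (1 / m) ^ 4 := hrm.trans (le_self_pow₀ hm1' (by norm_num))
    have a0 : 1 ≤ (1 / m) ^ 4 := one_le_pow₀ hm1'
    have a2 : r ^ 2 ≤ (1 / m) ^ 4 :=
      (pow_le_pow_left₀ hr0.le hrm 2).trans (pow_le_pow_right₀ hm1' (by norm_num))
    have a3 : r ^ 3 ≤ (1 / m) ^ 4 :=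
      (pow_le_pow_left₀ hr0.le hrm 3).trans (pow_le_pow_right₀ hm1' (by norm_num))
    have a4 : r ^ 4 ≤ (1 / m) ^ 4 := pow_le_pow_left₀ hr0.le hrm 4
    linarith
  have e1 : (Q ^ 5)⁻¹ - (P ^ 5)⁻¹ = (r - 1) * (1 + r + r ^ 2 + r ^ 3 + r ^ 4) * (P ^ 5)⁻¹ := by
    rw [show (r - 1) * (1 + r + r ^ 2 + r ^ 3 + r ^ 4) = r ^ 5 - 1 by ring, hr]
    field_simp
  rw [e1, abs_mul, abs_mul, abs_of_pos (show 0 < (P ^ 5)⁻¹ by positivity),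
    abs_of_pos (show 0 < 1 + r + r ^ 2 + r ^ 3 + r ^ 4 by positivity)]
  gcongr
  calc _ ≤ K * y * (1 / m) * (5 * (1 / m) ^ 4) := by gcongr
    _ = _ := by field_simp

lemma hasDerivAt_div_sqrt {b : ℝ} (hb : 0 < b) (x : ℝ) :
    HasDerivAt (fun x => x / √(x ^ 2 + b ^ 2)) (b ^ 2 * (√(x ^ 2 + b ^ 2) ^ 3)⁻¹) x := by
  have hp : 0 < x ^ 2 + b ^ 2 := by positivity
  have hs : 0 < √(x ^ 2 + b ^ 2) := Real.sqrt_pos.2 hp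
  have h1 : HasDerivAt (fun x : ℝ => x ^ 2 + b ^ 2) (2 * x) x := by
    simpa using (hasDerivAt_pow 2 x).add_const (b ^ 2)
  have h2 := (hasDerivAt_id x).div (h1.sqrt hp.ne') hs.ne'
  refine h2.congr_deriv ?_
  have hsq : √(x ^ 2 + b ^ 2) ^ 2 = x ^ 2 + b ^ 2 := Real.sq_sqrt hp.le
  simp only [id]
  field_simp
  rw [hsq]; ring

lemma continuous_inv_sqrt_pow {b : ℝ} (hb : 0 < b) (n : ℕ) :
    Continuous fun x : ℝ => (√(x ^ 2 + b ^ 2) ^ n)⁻¹ := by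
  refine Continuous.inv₀ (by fun_prop) fun x => ?_
  have : 0 < √(x ^ 2 + b ^ 2) := Real.sqrt_pos.2 (by positivity)
  positivity

/-- The even moments of the straight-line kernel `b² / (x² + b²)^{5/2}`, expressed through
`w = x / √(x² + b²)` at the right endpoint `x = 1/2`. -/
lemma integral_sq_mul_kernel {b : ℝ} (hb : 0 < b) :
    ∫ x in (-(1:ℝ)/2)..(1/2), b ^ 2 * (√(x ^ 2 + b ^ 2) ^ 5)⁻¹ * x ^ 2
      = 2 / 3 * ((1 / 2) / √((1 / 2) ^ 2 + b ^ 2)) ^ 3 := by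
  rw [intervalIntegral.integral_eq_sub_of_hasDerivAt
    (f := fun x => (x / √(x ^ 2 + b ^ 2)) ^ 3 / 3)]
  · rw [show (-(1:ℝ) / 2) ^ 2 = (1 / 2) ^ 2 by norm_num]; ring
  · intro x _
    refine (((hasDerivAt_div_sqrt hb x).pow 3).div_const 3).congr_deriv ?_
    have hs : 0 < √(x ^ 2 + b ^ 2) := Real.sqrt_pos.2 (by positivity)
    norm_num
    field_simp
  · have := continuous_inv_sqrt_pow hb 5
    exact Continuous.intervalIntegrable (by fun_prop) _ _

lemma integral_kernel {b : ℝ} (hb : 0 < b) :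
    ∫ x in (-(1:ℝ)/2)..(1/2), b ^ 2 * (√(x ^ 2 + b ^ 2) ^ 5)⁻¹
      = (b ^ 2)⁻¹ * (2 * ((1 / 2) / √((1 / 2) ^ 2 + b ^ 2))
          - 2 / 3 * ((1 / 2) / √((1 / 2) ^ 2 + b ^ 2)) ^ 3) := by
  rw [intervalIntegral.integral_eq_sub_of_hasDerivAt
    (f := fun x => (b ^ 2)⁻¹ * (x / √(x ^ 2 + b ^ 2) - (x / √(x ^ 2 + b ^ 2)) ^ 3 / 3))]
  · rw [show (-(1:ℝ) / 2) ^ 2 = (1 / 2) ^ 2 by norm_num]; ring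
  · intro x _
    refine (((hasDerivAt_div_sqrt hb x).sub
      (((hasDerivAt_div_sqrt hb x).pow 3).div_const 3)).const_mul _).congr_deriv ?_
    have hs : 0 < √(x ^ 2 + b ^ 2) := Real.sqrt_pos.2 (by positivity)
    have hsq : √(x ^ 2 + b ^ 2) ^ 2 = x ^ 2 + b ^ 2 := Real.sq_sqrt (by positivity)
    norm_num
    field_simp
    rw [hsq]; ring
  · have := continuous_inv_sqrt_pow hb 5
    exact Continuous.intervalIntegrable (by fun_prop) _ _

lemma integral_mul_kernel {b : ℝ} :
    ∫ x in (-(1:ℝ)/2)..(1/2), b ^ 2 * (√(x ^ 2 + b ^ 2) ^ 5)⁻¹ * x = 0 := by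
  have h := intervalIntegral.integral_comp_neg (a := -(1:ℝ)/2) (b := 1/2)
    (fun x : ℝ => b ^ 2 * (√(x ^ 2 + b ^ 2) ^ 5)⁻¹ * x)
  rw [show -(-(1:ℝ)/2) = 1/2 by norm_num, show -((1:ℝ)/2) = -(1:ℝ)/2 by norm_num] at h
  simp only [even_two.neg_pow, mul_neg, intervalIntegral.integral_neg] at h
  linarith

lemma integral_sq_div_le {b : ℝ} (hb : 0 < b) :
    ∫ x in (-(1:ℝ)/2)..(1/2), b ^ 2 / (x ^ 2 + b ^ 2) ≤ 4 * b := by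
  rw [intervalIntegral.integral_eq_sub_of_hasDerivAt (f := fun x => b * Real.arctan (x / b))]
  · have h1 := Real.arctan_lt_pi_div_two (1 / 2 / b)
    have h2 := Real.neg_pi_div_two_lt_arctan (-1 / 2 / b)
    have h3 := Real.pi_lt_four
    nlinarith
  · intro x _
    refine (((hasDerivAt_id x).div_const b).arctan.const_mul b).congr_deriv ?_
    have : 0 < x ^ 2 + b ^ 2 := by positivity
    simp only [id]
    field_simp
    ring
  · refine Continuous.intervalIntegrable ?_ _ _
    refine Continuous.div (by fun_prop) (by fun_prop) fun x => ?_
    positivity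

lemma one_sub_half_div_sqrt {b : ℝ} (hb : 0 < b) :
    (1 / 2) / √((1 / 2) ^ 2 + b ^ 2) ≤ 1 ∧ 1 - 2 * b ≤ (1 / 2) / √((1 / 2) ^ 2 + b ^ 2) := by
  have hs : 0 < √((1 / 2) ^ 2 + b ^ 2) := Real.sqrt_pos.2 (by positivity)
  have h1 : 1 / 2 ≤ √((1 / 2) ^ 2 + b ^ 2) := Real.le_sqrt_of_sq_le (by nlinarith)
  have h2 : √((1 / 2) ^ 2 + b ^ 2) ≤ 1 / 2 + b := Real.sqrt_le_iff.2 ⟨by positivity, by nlinarith⟩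
  refine ⟨by rw [div_le_one hs]; exact h1, ?_⟩
  rw [le_div_iff₀ hs]
  nlinarith

/-- A curve `R` close to the straight line `ε n + x t`, and a density `g`, on `|x| ≤ 1/2`. -/
structure NearLine (κ m ε F : ℝ) (t n g₀ : V3) (R g : ℝ → V3) : Prop where
  eps_pos : 0 < ε
  kappa_nonneg : 0 ≤ κ
  m_pos : 0 < m
  m_le_one : m ≤ 1
  norm_t : ‖t‖ = 1
  norm_n : ‖n‖ = 1
  orthogonal : ⟪n, t⟫ = 0
  continuous_R : Continuous R
  continuous_g : Continuous g
  near : ∀ x, |x| ≤ 1 / 2 → ‖R x - (ε • n + x • t)‖ ≤ κ * x ^ 2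
  lower : ∀ x, |x| ≤ 1 / 2 → m * (x ^ 2 + ε ^ 2) ≤ ‖R x‖ ^ 2
  norm_g : ∀ x, ‖g x‖ ≤ F
  norm_g₀ : ‖g₀‖ ≤ F
  g_sub : ∀ x, ‖g x - g₀‖ ≤ F * |x|

/-- The regularized kernel `b² (R·v) R / (|R|² + b² - ε²)^{5/2}`. -/
def lineKernel (ε b : ℝ) (R v : V3) : V3 :=
  (b ^ 2 * (√(‖R‖ ^ 2 + (b ^ 2 - ε ^ 2)) ^ 5)⁻¹ * ⟪R, v⟫) • R

namespace NearLine

variable {κ m ε F b : ℝ} {t n g₀ : V3} {R g : ℝ → V3}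

lemma norm_sq_line (h : NearLine κ m ε F t n g₀ R g) (x : ℝ) :
    ‖ε • n + x • t‖ ^ 2 = x ^ 2 + ε ^ 2 := by
  rw [norm_add_sq_real, norm_smul, norm_smul, inner_smul_left, inner_smul_right, h.orthogonal,
    h.norm_t, h.norm_n]
  simp
  ring

lemma radicand_lower (h : NearLine κ m ε F t n g₀ R g) (hb : ε ≤ b) {x : ℝ} (hx : |x| ≤ 1 / 2) :
    m * (x ^ 2 + b ^ 2) ≤ ‖R x‖ ^ 2 + (b ^ 2 - ε ^ 2) := by
  have h1 := h.lower x hx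
  have h2 : ε ^ 2 ≤ b ^ 2 := pow_le_pow_left₀ h.eps_pos.le hb 2
  nlinarith [h.m_le_one]

lemma continuousOn_lineKernel (h : NearLine κ m ε F t n g₀ R g) (hb : ε ≤ b) :
    ContinuousOn (fun x => lineKernel ε b (R x) (g x)) (Set.uIcc (-(1:ℝ)/2) (1/2)) := by
  have hR := h.continuous_R
  have hg := h.continuous_g
  have hb0 : 0 < b := h.eps_pos.trans_le hb
  unfold lineKernel
  refine ContinuousOn.smul (M := ℝ) ?_ hR.continuousOn
  refine ContinuousOn.mul (ContinuousOn.mul continuousOn_const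
    (ContinuousOn.inv₀ (Continuous.continuousOn (by fun_prop)) fun x hx => ?_))
    (Continuous.continuousOn (by fun_prop))
  rw [Set.uIcc_of_le (by norm_num)] at hx
  have hx' : |x| ≤ 1 / 2 := abs_le.2 ⟨by linarith [hx.1], hx.2⟩
  have := h.radicand_lower hb hx'
  have hm := h.m_pos
  have : 0 < ‖R x‖ ^ 2 + (b ^ 2 - ε ^ 2) := lt_of_lt_of_le (by positivity) this
  have := Real.sqrt_pos.2 this
  positivity

/-- Replacing the curve by its tangent line and freezing the density costs a relative error
of order `|x|` in the kernel. -/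
lemma norm_lineKernel_sub_le (h : NearLine κ m ε F t n g₀ R g) (hb : ε ≤ b) {x : ℝ}
    (hx : |x| ≤ 1 / 2) :
    ‖lineKernel ε b (R x) (g x) - lineKernel ε b (ε • n + x • t) g₀‖
      ≤ (5 * (2 * κ + κ ^ 2) / m ^ 5 * (1 + κ) ^ 2 + (1 + κ) ^ 2 + κ * (1 + κ) + κ) * F
          * (b ^ 2 / (x ^ 2 + b ^ 2)) := by
  have hε := h.eps_pos
  have hκ := h.kappa_nonneg
  have hm := h.m_pos
  have hm1 := h.m_le_one
  have hb0 : 0 < b := hε.trans_le hb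
  have hεb : ε ^ 2 ≤ b ^ 2 := pow_le_pow_left₀ hε.le hb 2
  have hF : 0 ≤ F := (norm_nonneg _).trans h.norm_g₀
  set L := ε • n + x • t with hL
  have hp : 0 < x ^ 2 + b ^ 2 := by positivity
  set P := √(x ^ 2 + b ^ 2) with hP
  have hP0 : 0 < P := Real.sqrt_pos.2 hp
  have hPsq : P ^ 2 = x ^ 2 + b ^ 2 := Real.sq_sqrt hp.le
  set Q := √(‖R x‖ ^ 2 + (b ^ 2 - ε ^ 2)) with hQ
  have hq := h.radicand_lower hb hx
  have hq0 : 0 < ‖R x‖ ^ 2 + (b ^ 2 - ε ^ 2) := lt_of_lt_of_le (by positivity) hq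
  have hQsq : Q ^ 2 = ‖R x‖ ^ 2 + (b ^ 2 - ε ^ 2) := Real.sq_sqrt hq0.le
  have hQP : m * P ≤ Q := by
    refine Real.le_sqrt_of_sq_le (le_trans ?_ hq)
    rw [mul_pow, hPsq]
    gcongr
    nlinarith
  have hLsq : ‖L‖ ^ 2 = x ^ 2 + ε ^ 2 := h.norm_sq_line x
  have hLP : ‖L‖ ≤ P := Real.le_sqrt_of_sq_le (by rw [hLsq]; linarith)
  have hxP : |x| ≤ P := Real.le_sqrt_of_sq_le (by rw [sq_abs]; nlinarith)
  have hE := h.near x hx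
  rw [← hL] at hE
  have hEP : ‖R x - L‖ ≤ κ * |x| * P := by
    refine hE.trans ?_
    rw [← sq_abs, sq, ← mul_assoc]
    gcongr
  have hEP' : ‖R x - L‖ ≤ κ * P := by
    refine hEP.trans ?_
    have : |x| ≤ 1 := by linarith
    gcongr
    nlinarith [abs_nonneg x]
  have hRP : ‖R x‖ ≤ (1 + κ) * P := by
    have := norm_le_norm_add_norm_sub L (R x)
    rw [norm_sub_rev] at this
    linarith
  have hdiff : |Q ^ 2 - P ^ 2| ≤ (2 * κ + κ ^ 2) * |x| * P ^ 2 := by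
    have e : Q ^ 2 - P ^ 2 = (‖R x‖ - ‖L‖) * (‖R x‖ + ‖L‖) := by
      rw [hQsq, hPsq]; linear_combination hLsq
    rw [e, abs_mul, abs_of_nonneg (by positivity : 0 ≤ ‖R x‖ + ‖L‖)]
    calc _ ≤ κ * |x| * P * ((1 + κ) * P + P) := by
          gcongr
          exact (abs_norm_sub_norm_le _ _).trans hEP
      _ = _ := by ring
  have hinv := abs_inv_pow_five_sub_le hP0 hm hm1 hQP (by positivity) hdiff
  have e0 : √(‖L‖ ^ 2 + (b ^ 2 - ε ^ 2)) = P := by rw [hLsq, hP]; congr 1; ring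
  have split : lineKernel ε b (R x) (g x) - lineKernel ε b L g₀
      = (b ^ 2 * ((Q ^ 5)⁻¹ - (P ^ 5)⁻¹) * ⟪R x, g x⟫) • R x
        + (b ^ 2 * (P ^ 5)⁻¹) • (⟪R x, g x - g₀⟫ • R x + ⟪R x - L, g₀⟫ • R x
          + ⟪L, g₀⟫ • (R x - L)) := by
    unfold lineKernel
    rw [e0, ← hQ, inner_sub_left, inner_sub_right]
    module
  rw [split]
  have b1 : ‖(b ^ 2 * ((Q ^ 5)⁻¹ - (P ^ 5)⁻¹) * ⟪R x, g x⟫) • R x‖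
      ≤ b ^ 2 * (5 * ((2 * κ + κ ^ 2) * |x|) / m ^ 5 * (P ^ 5)⁻¹) * ((1 + κ) * P * F)
        * ((1 + κ) * P) := by
    rw [norm_smul, Real.norm_eq_abs, abs_mul, abs_mul, abs_of_pos (by positivity : 0 < b ^ 2)]
    gcongr
    refine (abs_real_inner_le_norm _ _).trans ?_
    gcongr
    exact h.norm_g x
  have b2 : ‖⟪R x, g x - g₀⟫ • R x‖ ≤ (1 + κ) * P * (F * |x|) * ((1 + κ) * P) := by
    rw [norm_smul, Real.norm_eq_abs]
    gcongr
    refine (abs_real_inner_le_norm _ _).trans ?_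
    gcongr
    exact h.g_sub x
  have b3 : ‖⟪R x - L, g₀⟫ • R x‖ ≤ κ * |x| * P * F * ((1 + κ) * P) := by
    rw [norm_smul, Real.norm_eq_abs]
    gcongr
    refine (abs_real_inner_le_norm _ _).trans ?_
    gcongr
    exact h.norm_g₀
  have b4 : ‖⟪L, g₀⟫ • (R x - L)‖ ≤ P * F * (κ * |x| * P) := by
    rw [norm_smul, Real.norm_eq_abs]
    gcongr
    refine (abs_real_inner_le_norm _ _).trans ?_
    gcongr
    exact h.norm_g₀
  have b5 : ‖(b ^ 2 * (P ^ 5)⁻¹) • (⟪R x, g x - g₀⟫ • R x + ⟪R x - L, g₀⟫ • R x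
          + ⟪L, g₀⟫ • (R x - L))‖ ≤ (b ^ 2 * (P ^ 5)⁻¹) *
        ((1 + κ) * P * (F * |x|) * ((1 + κ) * P) + κ * |x| * P * F * ((1 + κ) * P)
          + P * F * (κ * |x| * P)) := by
    rw [norm_smul, Real.norm_eq_abs, abs_of_pos (by positivity : 0 < b ^ 2 * (P ^ 5)⁻¹)]
    gcongr
    exact (norm_add₃_le).trans (by gcongr)
  refine (norm_add_le _ _).trans ((add_le_add b1 b5).trans ?_)
  rw [← hPsq]
  calc _ = (5 * (2 * κ + κ ^ 2) / m ^ 5 * (1 + κ) ^ 2 + (1 + κ) ^ 2 + κ * (1 + κ) + κ) * F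
          * (b ^ 2 / P ^ 3 * |x|) := by field_simp; ring
    _ ≤ (5 * (2 * κ + κ ^ 2) / m ^ 5 * (1 + κ) ^ 2 + (1 + κ) ^ 2 + κ * (1 + κ) + κ) * F
          * (b ^ 2 / P ^ 3 * P) := by gcongr
    _ = _ := by field_simp

/-- The straight-line integral up to its tails. -/
lemma norm_integral_line_sub_le (h : NearLine κ m ε F t n g₀ R g) (hb : ε ≤ b) :
    ‖(∫ x in (-(1:ℝ)/2)..(1/2), lineKernel ε b (ε • n + x • t) g₀)
        - ((4 / 3 * (ε ^ 2 / b ^ 2) * ⟪n, g₀⟫) • n + (2 / 3 * ⟪t, g₀⟫) • t)‖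
      ≤ 8 * F * b := by
  have hε := h.eps_pos
  have hb0 : 0 < b := hε.trans_le hb
  have hF : 0 ≤ F := (norm_nonneg _).trans h.norm_g₀
  have hc := continuous_inv_sqrt_pow hb0 5
  have e (x : ℝ) : lineKernel ε b (ε • n + x • t) g₀
      = (b ^ 2 * (√(x ^ 2 + b ^ 2) ^ 5)⁻¹) • ((ε ^ 2 * ⟪n, g₀⟫) • n)
        + (b ^ 2 * (√(x ^ 2 + b ^ 2) ^ 5)⁻¹ * x) • ((ε * ⟪n, g₀⟫) • t + (ε * ⟪t, g₀⟫) • n)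
        + (b ^ 2 * (√(x ^ 2 + b ^ 2) ^ 5)⁻¹ * x ^ 2) • (⟪t, g₀⟫ • t) := by
    unfold lineKernel
    rw [h.norm_sq_line, show x ^ 2 + ε ^ 2 + (b ^ 2 - ε ^ 2) = x ^ 2 + b ^ 2 by ring,
      inner_add_left, real_inner_smul_left, real_inner_smul_left]
    module
  simp_rw [e]
  rw [intervalIntegral.integral_add, intervalIntegral.integral_add,
    intervalIntegral.integral_smul_const, intervalIntegral.integral_smul_const,
    intervalIntegral.integral_smul_const, integral_kernel hb0, integral_mul_kernel,
    integral_sq_mul_kernel hb0]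
  rotate_left
  all_goals try exact Continuous.intervalIntegrable (by fun_prop) _ _
  obtain ⟨w1, w2⟩ := one_sub_half_div_sqrt hb0
  have w0 : 0 ≤ (1 / 2) / √((1 / 2) ^ 2 + b ^ 2) := by positivity
  set w := (1 / 2) / √((1 / 2) ^ 2 + b ^ 2)
  have e2 : ((b ^ 2)⁻¹ * (2 * w - 2 / 3 * w ^ 3)) • (ε ^ 2 * ⟪n, g₀⟫) • n
        + (0:ℝ) • ((ε * ⟪n, g₀⟫) • t + (ε * ⟪t, g₀⟫) • n) + (2 / 3 * w ^ 3) • ⟪t, g₀⟫ • t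
        - ((4 / 3 * (ε ^ 2 / b ^ 2) * ⟪n, g₀⟫) • n + (2 / 3 * ⟪t, g₀⟫) • t)
      = (ε ^ 2 / b ^ 2 * (2 * w - 2 / 3 * w ^ 3 - 4 / 3) * ⟪n, g₀⟫) • n
        + ((2 / 3 * w ^ 3 - 2 / 3) * ⟪t, g₀⟫) • t := by
    module
  rw [e2]
  have in1 : |⟪n, g₀⟫| ≤ F := by
    have := abs_real_inner_le_norm n g₀
    rw [h.norm_n, one_mul] at this
    exact this.trans h.norm_g₀
  have in2 : |⟪t, g₀⟫| ≤ F := by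
    have := abs_real_inner_le_norm t g₀
    rw [h.norm_t, one_mul] at this
    exact this.trans h.norm_g₀
  have hr : ε ^ 2 / b ^ 2 ≤ 1 := by
    rw [div_le_one (by positivity)]; exact pow_le_pow_left₀ hε.le hb 2
  have w3 : w ^ 3 ≤ 1 := pow_le_one₀ w0 w1
  have w4 : 1 - w ^ 3 ≤ 6 * b := by nlinarith [mul_nonneg w0 w0, mul_nonneg w0 (sub_nonneg.2 w1)]
  have k1 : |2 * w - 2 / 3 * w ^ 3 - 4 / 3| ≤ 4 * b := by
    rw [abs_le]
    constructor
    · nlinarith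
    · nlinarith [mul_nonneg (mul_nonneg w0 w0) (sub_nonneg.2 w1),
        mul_nonneg w0 (sq_nonneg (w - 1)), sq_nonneg (w - 1)]
  have k2 : |2 / 3 * w ^ 3 - 2 / 3| ≤ 4 * b := by
    rw [abs_le]
    constructor <;> linarith
  refine (norm_add_le _ _).trans ?_
  rw [norm_smul, norm_smul, h.norm_n, h.norm_t, mul_one, mul_one, Real.norm_eq_abs,
    Real.norm_eq_abs, abs_mul, abs_mul, abs_mul,
    abs_of_pos (by positivity : 0 < ε ^ 2 / b ^ 2)]
  calc _ ≤ 1 * (4 * b) * F + 4 * b * F := by gcongr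
    _ = _ := by ring

lemma norm_integral_lineKernel_sub_le (h : NearLine κ m ε F t n g₀ R g) (hb : ε ≤ b) :
    ‖(∫ x in (-(1:ℝ)/2)..(1/2), lineKernel ε b (R x) (g x))
        - ((4 / 3 * (ε ^ 2 / b ^ 2) * ⟪n, g₀⟫) • n + (2 / 3 * ⟪t, g₀⟫) • t)‖
      ≤ (4 * (5 * (2 * κ + κ ^ 2) / m ^ 5 * (1 + κ) ^ 2 + (1 + κ) ^ 2 + κ * (1 + κ) + κ) + 8)
          * F * b := by
  have hκ := h.kappa_nonneg
  have hm := h.m_pos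
  have hb0 : 0 < b := h.eps_pos.trans_le hb
  have hF : 0 ≤ F := (norm_nonneg _).trans h.norm_g₀
  set K := 5 * (2 * κ + κ ^ 2) / m ^ 5 * (1 + κ) ^ 2 + (1 + κ) ^ 2 + κ * (1 + κ) + κ with hK
  have hK0 : 0 ≤ K := by positivity
  have hline : NearLine κ m ε F t n g₀ (fun x => ε • n + x • t) (fun _ => g₀) :=
    { h with
      continuous_R := by fun_prop
      continuous_g := by fun_prop
      near := fun x _ => by rw [sub_self, norm_zero]; positivity
      lower := fun x _ => by
        rw [h.norm_sq_line]
        exact mul_le_of_le_one_left (by positivity) h.m_le_one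
      norm_g := fun _ => h.norm_g₀
      g_sub := fun x => by rw [sub_self, norm_zero]; positivity }
  have i1 := (h.continuousOn_lineKernel hb).intervalIntegrable (μ := volume)
  have i2 := (hline.continuousOn_lineKernel hb).intervalIntegrable (μ := volume)
  have hcurve : ‖(∫ x in (-(1:ℝ)/2)..(1/2), lineKernel ε b (R x) (g x))
      - ∫ x in (-(1:ℝ)/2)..(1/2), lineKernel ε b (ε • n + x • t) g₀‖ ≤ K * F * (4 * b) := by
    rw [← intervalIntegral.integral_sub i1 i2]
    refine (intervalIntegral.norm_integral_le_of_norm_le (by norm_num)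
      (g := fun x => K * F * (b ^ 2 / (x ^ 2 + b ^ 2))) ?_ ?_).trans ?_
    · refine Filter.Eventually.of_forall fun x hx => h.norm_lineKernel_sub_le hb ?_
      exact abs_le.2 ⟨by linarith [hx.1], hx.2⟩
    · refine Continuous.intervalIntegrable ?_ _ _
      refine continuous_const.mul (Continuous.div (by fun_prop) (by fun_prop) fun x => ?_)
      positivity
    · rw [intervalIntegral.integral_const_mul]
      gcongr
      exact integral_sq_div_le hb0
  refine (norm_sub_le_norm_sub_add_norm_sub _ _ _).trans
    ((add_le_add hcurve (h.norm_integral_line_sub_le hb)).trans_eq ?_)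
  ring

end NearLine

lemma norm_le_C0norm {f : ℝ → V3} (hf : Continuous f) (hp : ∀ s, f (s + 1) = f s) (s : ℝ) :
    ‖f s‖ ≤ C0norm f := by
  have hper : Function.Periodic (fun s => ‖f s‖) 1 := fun s => by simp only [hp]
  exact le_ciSup (hper.compact_of_continuous one_ne_zero hf.norm).bddAbove s

lemma deriv_add_one_of_periodic {f : ℝ → V3} (hp : ∀ s, f (s + 1) = f s) (s : ℝ) :
    deriv f (s + 1) = deriv f s := by
  rw [← deriv_comp_add_const, show (fun x => f (x + 1)) = f from funext hp]

lemma norm_sub_le_C0norm_deriv {f : ℝ → V3} (hf : ContDiff ℝ 1 f) (hp : ∀ s, f (s + 1) = f s)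
    (s x : ℝ) : ‖f (s - x) - f s‖ ≤ C0norm (deriv f) * |x| := by
  have := convex_univ.norm_image_sub_le_of_norm_deriv_le (𝕜 := ℝ) (f := f) (x := s) (y := s - x)
    (fun y _ => (hf.differentiable one_ne_zero) y)
    (fun y _ => norm_le_C0norm (hf.continuous_deriv le_rfl) (deriv_add_one_of_periodic hp) y)
    (Set.mem_univ _) (Set.mem_univ _)
  simpa using this

namespace SlenderGeom

variable {cΓ κmax : ℝ} {X en1 en2 : ℝ → V3}

lemma kappa_nonneg (h : SlenderGeom cΓ κmax X en1 en2) : 0 ≤ κmax :=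
  (norm_nonneg _).trans (h.curvature_max 0)

lemma norm_taylor_le (h : SlenderGeom cΓ κmax X en1 en2) (s x : ℝ) :
    ‖X s - X (s - x) - x • deriv X s‖ ≤ κmax * x ^ 2 := by
  have hκ := h.kappa_nonneg
  have hX : Differentiable ℝ X := h.smooth.differentiable two_ne_zero
  have hX' : Differentiable ℝ (deriv X) :=
    ((contDiff_succ_iff_deriv (n := 1)).1 h.smooth).2.2.differentiable one_ne_zero
  have hlip (y : ℝ) : ‖deriv X s - deriv X (s - y)‖ ≤ κmax * |y| := by
    have := convex_univ.norm_image_sub_le_of_norm_deriv_le (𝕜 := ℝ) (f := deriv X)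
      (x := s - y) (y := s) (fun z _ => hX' z) (fun z _ => h.curvature_max z)
      (Set.mem_univ _) (Set.mem_univ _)
    simpa using this
  have hd (y : ℝ) : HasDerivAt (fun y => X s - X (s - y) - y • deriv X s)
      (deriv X (s - y) - deriv X s) y := by
    have h1 : HasDerivAt (fun y => X (s - y)) (-deriv X (s - y)) y :=
      ((hX (s - y)).hasDerivAt.scomp y ((hasDerivAt_id y).const_sub s)).congr_deriv (by simp)
    exact ((h1.const_sub (X s)).sub ((hasDerivAt_id y).smul_const (deriv X s))).congr_deriv
      (by simp)
  have := (convex_uIcc (0:ℝ) x).norm_image_sub_le_of_norm_hasDerivWithin_le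
    (C := κmax * |x|) (fun y _ => (hd y).hasDerivWithinAt) (fun y hy => ?_)
    Set.left_mem_uIcc Set.right_mem_uIcc
  · simpa [mul_assoc, ← sq] using this
  · rw [norm_sub_rev]
    refine (hlip y).trans (mul_le_mul_of_nonneg_left ?_ hκ)
    simpa using Set.abs_sub_left_of_mem_uIcc hy

lemma norm_ePerp (h : SlenderGeom cΓ κmax X en1 en2) (s θ : ℝ) : ‖ePerp en1 en2 s θ‖ = 1 := by
  rw [← sq_eq_sq₀ (norm_nonneg _) zero_le_one, ePerp, norm_add_sq_real, norm_smul, norm_smul,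
    inner_smul_left, inner_smul_right, h.en1_en2, h.en1_unit, h.en2_unit]
  simp

lemma inner_ePerp (h : SlenderGeom cΓ κmax X en1 en2) (s θ : ℝ) :
    ⟪ePerp en1 en2 s θ, deriv X s⟫ = 0 := by
  rw [ePerp, inner_add_left, real_inner_smul_left, real_inner_smul_left, real_inner_comm,
    h.es_en1, real_inner_comm, h.es_en2]
  simp

lemma norm_Rvec_sq_lower (h : SlenderGeom cΓ κmax X en1 en2) (hc : 0 < cΓ) {ε : ℝ} (hε : 0 < ε)
    (hε' : ε * κmax ≤ cΓ ^ 2 / 4) (s θ : ℝ) {x : ℝ} (hx : |x| ≤ 1 / 2) :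
    min 1 (cΓ ^ 2 / 2) * (x ^ 2 + ε ^ 2) ≤ ‖Rvec X en1 en2 ε s x θ‖ ^ 2 := by
  set n := ePerp en1 en2 s θ with hn
  have hY : cΓ * |x| ≤ ‖X s - X (s - x)‖ := by
    simpa using h.no_self_intersect s (s - x) (by simpa using hx)
  have hYsq : cΓ ^ 2 * x ^ 2 ≤ ‖X s - X (s - x)‖ ^ 2 := by
    rw [← sq_abs x, ← mul_pow]
    exact pow_le_pow_left₀ (by positivity) hY 2
  have hin : |⟪n, X s - X (s - x)⟫| ≤ κmax * x ^ 2 := by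
    have e : ⟪n, X s - X (s - x)⟫ = ⟪n, X s - X (s - x) - x • deriv X s⟫ := by
      rw [inner_sub_right _ _ (x • deriv X s), real_inner_smul_right, h.inner_ePerp]
      simp
    rw [e]
    refine (abs_real_inner_le_norm _ _).trans ?_
    rw [h.norm_ePerp, one_mul]
    exact h.norm_taylor_le s x
  have hR : ‖Rvec X en1 en2 ε s x θ‖ ^ 2
      = ε ^ 2 + 2 * (ε * ⟪n, X s - X (s - x)⟫) + ‖X s - X (s - x)‖ ^ 2 := by
    rw [Rvec, ← hn, show X s + ε • n - X (s - x) = ε • n + (X s - X (s - x)) by abel,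
      norm_add_sq_real, norm_smul, h.norm_ePerp, real_inner_smul_left]
    simp
  rw [hR]
  have h1 : -(cΓ ^ 2 / 4 * x ^ 2) ≤ ε * ⟪n, X s - X (s - x)⟫ := by
    have := neg_le_of_abs_le hin
    nlinarith [sq_nonneg x]
  nlinarith [min_le_left 1 (cΓ ^ 2 / 2), min_le_right 1 (cΓ ^ 2 / 2), sq_nonneg x, sq_nonneg ε]

lemma nearLine (h : SlenderGeom cΓ κmax X en1 en2) (hc : 0 < cΓ) {ε : ℝ} (hε : 0 < ε)
    (hε' : ε * κmax ≤ cΓ ^ 2 / 4) {f : ℝ → V3} (hf : ContDiff ℝ 1 f)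
    (hp : ∀ s, f (s + 1) = f s) (s θ : ℝ) :
    NearLine κmax (min 1 (cΓ ^ 2 / 2)) ε (C1norm f) (deriv X s) (ePerp en1 en2 s θ) (f s)
      (fun x => Rvec X en1 en2 ε s x θ) (fun x => f (s - x)) := by
  have hX : Continuous X := h.smooth.continuous
  have hfc : Continuous f := hf.continuous
  have h0 : 0 ≤ C0norm f := (norm_nonneg _).trans (norm_le_C0norm hfc hp 0)
  have h1 : 0 ≤ C0norm (deriv f) := (norm_nonneg _).trans
    (norm_le_C0norm (hf.continuous_deriv le_rfl) (deriv_add_one_of_periodic hp) 0)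
  have hle (y : ℝ) : ‖f y‖ ≤ C1norm f := by
    have := norm_le_C0norm hfc hp y
    unfold C1norm
    linarith
  exact
    { eps_pos := hε
      kappa_nonneg := h.kappa_nonneg
      m_pos := by positivity
      m_le_one := min_le_left _ _
      norm_t := h.arclength s
      norm_n := h.norm_ePerp s θ
      orthogonal := h.inner_ePerp s θ
      continuous_R := by unfold Rvec; fun_prop
      continuous_g := by fun_prop
      near := fun x _ => by
        rw [Rvec, show X s + ε • ePerp en1 en2 s θ - X (s - x)
          - (ε • ePerp en1 en2 s θ + x • deriv X s) = X s - X (s - x) - x • deriv X s by abel]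
        exact h.norm_taylor_le s x
      lower := fun x hx => h.norm_Rvec_sq_lower hc hε hε' s θ hx
      norm_g := fun x => hle _
      norm_g₀ := hle _
      g_sub := fun x => (norm_sub_le_C0norm_deriv hf hp s x).trans
        (by unfold C1norm; gcongr; linarith) }

end SlenderGeom

lemma rpow_five_halves {y : ℝ} (hy : 0 ≤ y) : y ^ ((5 : ℝ) / 2) = √y ^ 5 := by
  rw [Real.sqrt_eq_rpow, ← Real.rpow_natCast, ← Real.rpow_mul hy]
  norm_num

/-- Second doublet difference term at the fiber surface:
`|D₂ − (2δ²/(ε²+δ²)) e_ρ(e_ρ·f)| ≤ C √(ε²+δ²) ‖f‖_{C¹}`. -/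
theorem surface_doublet_term_D2 (cΓ κmax : ℝ) (hcΓ : 0 < cΓ) :
    ∃ C > 0, ∃ ε₀ > 0,
      ∀ X en1 en2 : ℝ → V3, SlenderGeom cΓ κmax X en1 en2 →
      ∀ ε δ : ℝ, 0 < ε → ε < ε₀ → 0 < δ → δ < ε₀ →
      ∀ f : ℝ → V3, ContDiff ℝ 1 f → (∀ s, f (s + 1) = f s) →
      ∀ s θ : ℝ,
        ‖(-(3 / 2 : ℝ)) • (∫ sb in (-(1:ℝ)/2)..(1/2),
              (((ε ^ 2 + δ ^ 2)
                      * ((‖Rvec X en1 en2 ε s sb θ‖ ^ 2 + δ ^ 2) ^ ((5 : ℝ) / 2))⁻¹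
                    - ε ^ 2 * (‖Rvec X en1 en2 ε s sb θ‖ ^ 5)⁻¹)
                  * ⟪Rvec X en1 en2 ε s sb θ, f (s - sb)⟫) • Rvec X en1 en2 ε s sb θ)
            - (2 * δ ^ 2 / (ε ^ 2 + δ ^ 2))
                • ⟪ePerp en1 en2 s θ, f s⟫ • ePerp en1 en2 s θ‖
          ≤ C * (ε ^ 2 + δ ^ 2) ^ ((1 : ℝ) / 2) * C1norm f := by
  set κ := |κmax| with hκ
  set m := min 1 (cΓ ^ 2 / 2) with hm
  have hm0 : 0 < m := by positivity
  set K := 4 * (5 * (2 * κ + κ ^ 2) / m ^ 5 * (1 + κ) ^ 2 + (1 + κ) ^ 2 + κ * (1 + κ) + κ) + 8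
    with hK
  have hK0 : 0 < K := by positivity
  refine ⟨3 * K, by positivity, cΓ ^ 2 / 4 / (κ + 1), by positivity, ?_⟩
  intro X en1 en2 h ε δ hε hε₀ hδ _ f hf hp s θ
  have hκmax : κmax = κ := (abs_of_nonneg h.kappa_nonneg).symm
  have hsmall : ε * κmax ≤ cΓ ^ 2 / 4 := by
    rw [lt_div_iff₀ (by positivity)] at hε₀
    rw [hκmax]
    linarith
  have hN := h.nearLine hcΓ hε hsmall hf hp s θ
  rw [hκmax] at hN
  rw [← Real.sqrt_eq_rpow]
  set a := √(ε ^ 2 + δ ^ 2) with ha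
  have hasq : a ^ 2 = ε ^ 2 + δ ^ 2 := Real.sq_sqrt (by positivity)
  have hεa : ε ≤ a := Real.le_sqrt_of_sq_le (by nlinarith)
  have Ba := hN.norm_integral_lineKernel_sub_le hεa
  have Bε := hN.norm_integral_lineKernel_sub_le le_rfl
  have ia := (hN.continuousOn_lineKernel hεa).intervalIntegrable (μ := volume)
  have iε := (hN.continuousOn_lineKernel le_rfl).intervalIntegrable (μ := volume)
  have e (x : ℝ) : (((ε ^ 2 + δ ^ 2)
          * ((‖Rvec X en1 en2 ε s x θ‖ ^ 2 + δ ^ 2) ^ ((5 : ℝ) / 2))⁻¹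
        - ε ^ 2 * (‖Rvec X en1 en2 ε s x θ‖ ^ 5)⁻¹)
      * ⟪Rvec X en1 en2 ε s x θ, f (s - x)⟫) • Rvec X en1 en2 ε s x θ
      = lineKernel ε a (Rvec X en1 en2 ε s x θ) (f (s - x))
        - lineKernel ε ε (Rvec X en1 en2 ε s x θ) (f (s - x)) := by
    rw [lineKernel, lineKernel, hasq, rpow_five_halves (by positivity), sub_self, add_zero,
      Real.sqrt_sq (norm_nonneg _), add_sub_cancel_left, ← sub_smul, ← sub_mul]
  simp_rw [e]
  rw [intervalIntegral.integral_sub ia iε]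
  rw [← hK] at Ba Bε
  set n := ePerp en1 en2 s θ
  set Ia := ∫ x in (-(1:ℝ)/2)..(1/2), lineKernel ε a (Rvec X en1 en2 ε s x θ) (f (s - x))
  set Iε := ∫ x in (-(1:ℝ)/2)..(1/2), lineKernel ε ε (Rvec X en1 en2 ε s x θ) (f (s - x))
  have hF : 0 ≤ C1norm f := (norm_nonneg _).trans hN.norm_g₀
  have hcoef : 2 * δ ^ 2 / (ε ^ 2 + δ ^ 2)
      = -(3 / 2) * (4 / 3 * (ε ^ 2 / a ^ 2) - 4 / 3 * (ε ^ 2 / ε ^ 2)) := by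
    rw [hasq]
    field_simp
    ring
  rw [hcoef]
  have split : (-(3 / 2 : ℝ)) • (Ia - Iε)
      - (-(3 / 2 : ℝ) * (4 / 3 * (ε ^ 2 / a ^ 2) - 4 / 3 * (ε ^ 2 / ε ^ 2))) • ⟪n, f s⟫ • n
      = (3 / 2 : ℝ) • ((Iε - ((4 / 3 * (ε ^ 2 / ε ^ 2) * ⟪n, f s⟫) • n
            + (2 / 3 * ⟪deriv X s, f s⟫) • deriv X s))
          - (Ia - ((4 / 3 * (ε ^ 2 / a ^ 2) * ⟪n, f s⟫) • n
            + (2 / 3 * ⟪deriv X s, f s⟫) • deriv X s))) := by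
    module
  rw [split, norm_smul, Real.norm_of_nonneg (by norm_num)]
  calc _ ≤ 3 / 2 * (K * C1norm f * ε + K * C1norm f * a) := by
        gcongr
        exact (norm_sub_le _ _).trans (add_le_add Bε Ba)
    _ ≤ 3 / 2 * (K * C1norm f * a + K * C1norm f * a) := by gcongr
    _ = _ := by ring
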